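/- For every m ∈ ℕ, the set F_m of all non-expansive functions from P^m to P, equipped with the distance l_m(a,b) = (1/2)·inf{2⁻ⁿ + 2⁻⁽ⁿ⁺ᵏ⁾ : a ∼_{n,k} b}, is a spherically complete ultrametric space. -/

import Mathlib

inductive Formula : Type
  | atom : ℕ → Formula
  | bot  : Formula
  | imp  : Formula → Formula → Formula
  | box  : Formula → Formula
deriving DecidableEq

def boxtimes (Γ : Multiset Formula) : Multiset Formula := Γ + Γ.map Formula.box

inductive GoSeq : Bool → Multiset Formula → Multiset Formula → Prop
  | ax (c) (Γ Δ : Multiset Formula) (A : Formula) : GoSeq c (A ::ₘ Γ) (A ::ₘ Δ)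
  | axBot (c) (Γ Δ : Multiset Formula) : GoSeq c (Formula.bot ::ₘ Γ) Δ
  | impL (c) (Γ Δ : Multiset Formula) (A B : Formula) :
      GoSeq c (B ::ₘ Γ) Δ → GoSeq c Γ (A ::ₘ Δ) → GoSeq c ((A.imp B) ::ₘ Γ) Δ
  | impR (c) (Γ Δ : Multiset Formula) (A B : Formula) :
      GoSeq c (A ::ₘ Γ) (B ::ₘ Δ) → GoSeq c Γ ((A.imp B) ::ₘ Δ)
  | boxGo (c) (Γ Δ Θ : Multiset Formula) (A : Formula) :
      GoSeq c ((Formula.box (A.imp (Formula.box A))) ::ₘ boxtimes Θ) {A} →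
      GoSeq c (Γ + Θ.map Formula.box) ((Formula.box A) ::ₘ Δ)
  | cut (Γ Δ : Multiset Formula) (A : Formula) :
      GoSeq true Γ (A ::ₘ Δ) → GoSeq true (A ::ₘ Γ) Δ → GoSeq true Γ Δ

inductive Frag : Bool → ℕ → Multiset Formula → Multiset Formula → Type
  | hole (c) (Γ Δ : Multiset Formula) : Frag c 0 Γ Δ
  | axP (c) (n) (Γ Δ : Multiset Formula) (p : ℕ) :
      Frag c (n+1) (Formula.atom p ::ₘ Γ) (Formula.atom p ::ₘ Δ)
  | axBot (c) (n) (Γ Δ : Multiset Formula) : Frag c (n+1) (Formula.bot ::ₘ Γ) Δ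
  | impL (c) (n) (Γ Δ : Multiset Formula) (A B : Formula) :
      Frag c (n+1) (B ::ₘ Γ) Δ → Frag c (n+1) Γ (A ::ₘ Δ) →
      Frag c (n+1) ((A.imp B) ::ₘ Γ) Δ
  | impR (c) (n) (Γ Δ : Multiset Formula) (A B : Formula) :
      Frag c (n+1) (A ::ₘ Γ) (B ::ₘ Δ) → Frag c (n+1) Γ ((A.imp B) ::ₘ Δ)
  | box (c) (n) (Γ Δ Θ : Multiset Formula) (l : List Formula) (h : l ≠ []) :
      Frag c (n+1) (boxtimes Θ) (boxtimes (↑l)) →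
      ((i : Fin l.length) → Frag c n (boxtimes Θ) {l.get i}) →
      Frag c (n+1) (Γ + Θ.map Formula.box) ((↑(l.map Formula.box) : Multiset Formula) + Δ)
  | cut (n) (Γ Δ : Multiset Formula) (A : Formula) :
      Frag true (n+1) Γ (A ::ₘ Δ) → Frag true (n+1) (A ::ₘ Γ) Δ → Frag true (n+1) Γ Δ

def Frag.trunc : ∀ {c : Bool} {n : ℕ} {Γ Δ : Multiset Formula}, Frag c (n+1) Γ Δ → Frag c n Γ Δ
  | c, 0, Γ, Δ, _ => .hole c Γ Δ
  | c, n+1, _, _, .axP _ _ Γ Δ p => .axP c n Γ Δ p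
  | c, n+1, _, _, .axBot _ _ Γ Δ => .axBot c n Γ Δ
  | c, n+1, _, _, .impL _ _ Γ Δ A B a b => .impL c n Γ Δ A B a.trunc b.trunc
  | c, n+1, _, _, .impR _ _ Γ Δ A B a => .impR c n Γ Δ A B a.trunc
  | c, n+1, _, _, .box _ _ Γ Δ Θ l h a bs => .box c n Γ Δ Θ l h a.trunc (fun i => (bs i).trunc)
  | _, n+1, _, _, .cut _ Γ Δ A a b => .cut n Γ Δ A a.trunc b.trunc

def Frag.height : ∀ {c : Bool} {n : ℕ} {Γ Δ : Multiset Formula}, Frag c n Γ Δ → ℕ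
  | _, _, _, _, .hole _ _ _ => 0
  | _, _, _, _, .axP _ _ _ _ _ => 0
  | _, _, _, _, .axBot _ _ _ _ => 0
  | _, _, _, _, .impL _ _ _ _ _ _ a b => max a.height b.height + 1
  | _, _, _, _, .impR _ _ _ _ _ _ a => a.height + 1
  | _, _, _, _, .box _ _ _ _ _ _ _ a bs =>
      max a.height (Finset.univ.sup fun i => (bs i).height) + 1
  | _, _, _, _, .cut _ _ _ _ a b => max a.height b.height + 1

def Frag.cutFree : ∀ {c : Bool} {n : ℕ} {Γ Δ : Multiset Formula}, Frag c n Γ Δ → Prop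
  | _, _, _, _, .hole _ _ _ => True
  | _, _, _, _, .axP _ _ _ _ _ => True
  | _, _, _, _, .axBot _ _ _ _ => True
  | _, _, _, _, .impL _ _ _ _ _ _ a b => a.cutFree ∧ b.cutFree
  | _, _, _, _, .impR _ _ _ _ _ _ a => a.cutFree
  | _, _, _, _, .box _ _ _ _ _ _ _ a bs => a.cutFree ∧ ∀ i, (bs i).cutFree
  | _, _, _, _, .cut _ _ _ _ _ _ => False

structure InfProof (c : Bool) (Γ Δ : Multiset Formula) : Type where
  frag : ∀ n : ℕ, Frag c n Γ Δ
  compat : ∀ n : ℕ, (frag (n+1)).trunc = frag n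

structure PP : Type where
  Γ : Multiset Formula
  Δ : Multiset Formula
  prf : InfProof true Γ Δ

def Sim : ℕ → PP → PP → Prop
  | 0, _, _ => True
  | n+1, π, τ => π.Γ = τ.Γ ∧ π.Δ = τ.Δ ∧ HEq (π.prf.frag (n+1)) (τ.prf.frag (n+1))

noncomputable def dP (π τ : PP) : ℝ :=
  sInf {r : ℝ | ∃ n : ℕ, Sim n π τ ∧ r = (1/2 : ℝ) ^ n}

def localHeight (π : PP) : ℕ := (π.prf.frag 1).height

def Pmem (n : ℕ) (π : PP) : Prop := (π.prf.frag n).cutFree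

def IsUltrametric {M : Type*} (d : M → M → ℝ) : Prop :=
  (∀ x y, 0 ≤ d x y) ∧ (∀ x y, d x y = 0 ↔ x = y) ∧ (∀ x y, d x y = d y x) ∧
  (∀ x y z, d x z ≤ max (d x y) (d y z))

def cBall {M : Type*} (d : M → M → ℝ) (x : M) (r : ℝ) : Set M := {y | d x y ≤ r}

def SphericallyComplete {M : Type*} (d : M → M → ℝ) : Prop :=
  ∀ (c : ℕ → M) (r : ℕ → ℝ), (∀ n, 0 ≤ r n) →
    (∀ n, cBall d (c (n+1)) (r (n+1)) ⊆ cBall d (c n) (r n)) →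
    ∃ x, ∀ n, x ∈ cBall d (c n) (r n)

def NonExpansive1 (u : PP → PP) : Prop := ∀ π τ, dP (u π) (u τ) ≤ dP π τ

def Adequate1 (u : PP → PP) : Prop := ∀ n π, Pmem n π → Pmem n (u π)

noncomputable def dPm {m : ℕ} (x y : Fin m → PP) : ℝ := ⨆ i, dP (x i) (y i)

def NonExpansiveM {m : ℕ} (u : (Fin m → PP) → PP) : Prop :=
  ∀ x y, dP (u x) (u y) ≤ dPm x y

def Fm (m : ℕ) : Type := {u : (Fin m → PP) → PP // NonExpansiveM u}

def SimF {m : ℕ} (n k : ℕ) (a b : (Fin m → PP) → PP) : Prop :=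
  (∀ x, Sim n (a x) (b x)) ∧
  (∀ x, (∑ i, localHeight (x i)) < k → Sim (n+1) (a x) (b x))

noncomputable def lm {m : ℕ} (a b : (Fin m → PP) → PP) : ℝ :=
  (1/2) * sInf {r : ℝ | ∃ n k : ℕ, SimF n k a b ∧ r = (1/2 : ℝ) ^ n + (1/2 : ℝ) ^ (n + k)}

noncomputable def dP2 (p q : PP × PP) : ℝ := max (dP p.1 q.1) (dP p.2 q.2)

def NonExpansive2 (u : PP × PP → PP) : Prop := ∀ p q, dP (u p) (u q) ≤ dP2 p q

def Adequate2 (u : PP × PP → PP) : Prop :=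
  ∀ n π τ, Pmem n π → Pmem n τ → Pmem n (u (π, τ))

def Removing (A : Formula) (u : PP × PP → PP) : Prop :=
  ∀ (Γ Δ : Multiset Formula) (π τ : PP),
    π.Γ = Γ → π.Δ = A ::ₘ Δ → τ.Γ = A ::ₘ Γ → τ.Δ = Δ →
    (u (π, τ)).Γ = Γ ∧ (u (π, τ)).Δ = Δ

def RA (A : Formula) : Type := {u : PP × PP → PP // NonExpansive2 u ∧ Removing A u}

def SimF2 (n k : ℕ) (a b : PP × PP → PP) : Prop :=
  (∀ p, Sim n (a p) (b p)) ∧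
  (∀ p : PP × PP, localHeight p.1 + localHeight p.2 < k → Sim (n+1) (a p) (b p))

noncomputable def l2 (a b : PP × PP → PP) : ℝ :=
  (1/2) * sInf {r : ℝ | ∃ n k : ℕ, SimF2 n k a b ∧ r = (1/2 : ℝ) ^ n + (1/2 : ℝ) ^ (n + k)}

theorem Sim.refl : ∀ (n : ℕ) (π : PP), Sim n π π
  | 0, _ => trivial
  | _ + 1, _ => ⟨rfl, rfl, HEq.rfl⟩

theorem Sim.symm : ∀ {n : ℕ} {π τ : PP}, Sim n π τ → Sim n τ π
  | 0, _, _, _ => trivial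
  | _ + 1, _, _, ⟨h₁, h₂, h₃⟩ => ⟨h₁.symm, h₂.symm, h₃.symm⟩

theorem Sim.trans : ∀ {n : ℕ} {π τ σ : PP}, Sim n π τ → Sim n τ σ → Sim n π σ
  | 0, _, _, _, _, _ => trivial
  | _ + 1, _, _, _, ⟨h₁, h₂, h₃⟩, ⟨g₁, g₂, g₃⟩ => ⟨h₁.trans g₁, h₂.trans g₂, h₃.trans g₃⟩

theorem InfProof.frag_eq_of_succ {c : Bool} {Γ Δ : Multiset Formula} {p q : InfProof c Γ Δ} {n : ℕ}
    (h : p.frag (n + 1) = q.frag (n + 1)) : p.frag n = q.frag n := by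
  rw [← p.compat, ← q.compat, h]

theorem Sim.of_succ : ∀ {n : ℕ} {π τ : PP}, Sim (n + 1) π τ → Sim n π τ
  | 0, _, _, _ => trivial
  | n + 1, ⟨Γ, Δ, p⟩, ⟨Γ', Δ', q⟩, ⟨h₁, h₂, h₃⟩ => by
    dsimp only at h₁ h₂
    subst h₁ h₂
    exact ⟨rfl, rfl, heq_of_eq (InfProof.frag_eq_of_succ (eq_of_heq h₃))⟩

theorem Sim.mono {k n : ℕ} (hkn : k ≤ n) {π τ : PP} (h : Sim n π τ) : Sim k π τ := by
  induction hkn with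
  | refl => exact h
  | step _ ih => exact ih h.of_succ

theorem eq_of_forall_sim {π τ : PP} (h : ∀ n, Sim (n + 1) π τ) : π = τ := by
  obtain ⟨Γ, Δ, p⟩ := π
  obtain ⟨Γ', Δ', q⟩ := τ
  obtain ⟨h₁, h₂, -⟩ := h 0
  dsimp only at h₁ h₂
  subst h₁ h₂
  have hpq : p.frag = q.frag :=
    funext fun n => InfProof.frag_eq_of_succ (eq_of_heq (h n).2.2)
  cases p
  cases q
  cases hpq
  rfl

theorem localHeight_eq_of_sim {n : ℕ} {π τ : PP} (h : Sim (n + 1) π τ) :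
    localHeight π = localHeight τ := by
  obtain ⟨Γ, Δ, p⟩ := π
  obtain ⟨Γ', Δ', q⟩ := τ
  obtain ⟨h₁, h₂, h₃⟩ := h.mono (Nat.le_add_left 1 n)
  dsimp only at h₁ h₂
  subst h₁ h₂
  exact congrArg Frag.height (eq_of_heq h₃)

/-- The limit of a Cauchy sequence of ∞-proofs. -/
theorem exists_limit (p : ℕ → PP) (hp : ∀ n, Sim (n + 1) (p n) (p (n + 1))) :
    ∃ q, ∀ n, Sim (n + 1) (p n) q := by
  have h₁ : ∀ n, Sim 1 (p 0) (p n) := fun n => by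
    induction n with
    | zero => exact Sim.refl _ _
    | succ n ih => exact ih.trans ((hp n).mono (Nat.le_add_left 1 n))
  have h₂ : ∀ n, ∃ f : InfProof true (p 0).Γ (p 0).Δ, p n = ⟨_, _, f⟩ := fun n => by
    obtain ⟨hΓ, hΔ, -⟩ := h₁ n
    rw [hΓ, hΔ]
    exact ⟨(p n).prf, rfl⟩
  choose f hf using h₂
  have h₃ : ∀ n, (f n).frag (n + 1) = (f (n + 1)).frag (n + 1) := fun n => by
    have := hp n
    rw [hf n, hf (n + 1)] at this
    exact eq_of_heq this.2.2
  refine ⟨⟨_, _, fun n => (f n).frag n, fun n => ?_⟩, fun n => ?_⟩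
  · rw [(f (n + 1)).compat, InfProof.frag_eq_of_succ (h₃ n)]
  · rw [hf n]
    exact ⟨rfl, rfl, heq_of_eq (h₃ n)⟩

theorem half_pow_lt_iff {k n : ℕ} : (1 / 2 : ℝ) ^ k < (1 / 2 : ℝ) ^ n ↔ n < k :=
  pow_lt_pow_iff_right_of_lt_one₀ (by norm_num) (by norm_num)

theorem half_pow_le_iff {k n : ℕ} : (1 / 2 : ℝ) ^ k ≤ (1 / 2 : ℝ) ^ n ↔ n ≤ k :=
  pow_le_pow_iff_right_of_lt_one₀ (by norm_num) (by norm_num)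

theorem dP_nonneg (π τ : PP) : 0 ≤ dP π τ :=
  Real.sInf_nonneg fun _ ⟨_, _, hr⟩ => hr ▸ by positivity

theorem dP_le_of_sim {n : ℕ} {π τ : PP} (h : Sim n π τ) : dP π τ ≤ (1 / 2) ^ n :=
  csInf_le ⟨0, fun _ ⟨_, _, hr⟩ => hr ▸ by positivity⟩ ⟨n, h, rfl⟩

theorem exists_sim_of_dP_lt {π τ : PP} {r : ℝ} (h : dP π τ < r) :
    ∃ n, Sim n π τ ∧ (1 / 2 : ℝ) ^ n < r := by
  obtain ⟨_, ⟨n, hn, rfl⟩, hr⟩ := exists_lt_of_csInf_lt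
    (s := {r : ℝ | ∃ n : ℕ, Sim n π τ ∧ r = (1/2 : ℝ) ^ n}) ⟨_, 0, trivial, rfl⟩ h
  exact ⟨n, hn, hr⟩

theorem dP_le_half_pow_iff {n : ℕ} {π τ : PP} : dP π τ ≤ (1 / 2) ^ n ↔ Sim n π τ := by
  refine ⟨fun h => ?_, dP_le_of_sim⟩
  cases n with
  | zero => trivial
  | succ n =>
    obtain ⟨k, hk, hlt⟩ := exists_sim_of_dP_lt (h.trans_lt (half_pow_lt_iff.2 n.lt_succ_self))
    exact hk.mono (half_pow_lt_iff.1 hlt)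

theorem nonExpansiveM_iff {m : ℕ} {u : (Fin m → PP) → PP} :
    NonExpansiveM u ↔ ∀ n x y, (∀ i, Sim n (x i) (y i)) → Sim n (u x) (u y) := by
  refine ⟨fun h n x y hxy => dP_le_half_pow_iff.1 ((h x y).trans ?_), fun h x y => ?_⟩
  · exact Real.iSup_le (fun i => dP_le_of_sim (hxy i)) (by positivity)
  · by_contra! hlt
    have hle : ∀ i, dP (x i) (y i) ≤ dPm x y :=
      fun i => le_ciSup (f := fun i => dP (x i) (y i)) (Set.finite_range _).bddAbove i
    have h0 : 0 ≤ dPm x y := Real.iSup_nonneg fun i => dP_nonneg _ _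
    have hex : ∃ n : ℕ, (1 / 2 : ℝ) ^ n < dP (u x) (u y) :=
      exists_pow_lt_of_lt_one (h0.trans_lt hlt) (by norm_num)
    classical
    refine (Nat.find_spec hex).not_ge (dP_le_of_sim (h _ x y fun i => ?_))
    obtain ⟨k, hk, hklt⟩ := exists_sim_of_dP_lt ((hle i).trans_lt hlt)
    exact hk.mono (Nat.find_min' hex hklt)

section Distance

variable {m : ℕ} {a b : (Fin m → PP) → PP}

theorem lm_nonneg : 0 ≤ lm a b :=
  mul_nonneg (by norm_num) (Real.sInf_nonneg fun _ ⟨_, _, _, hr⟩ => hr ▸ by positivity)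

theorem lm_le_of_simF {n k : ℕ} (h : SimF n k a b) :
    lm a b ≤ 1 / 2 * ((1 / 2) ^ n + (1 / 2) ^ (n + k)) :=
  mul_le_mul_of_nonneg_left
    (csInf_le ⟨0, fun _ ⟨_, _, _, hr⟩ => hr ▸ by positivity⟩ ⟨n, k, h, rfl⟩) (by norm_num)

theorem exists_simF_of_lm_lt {r : ℝ} (h : lm a b < 1 / 2 * r) :
    ∃ n k : ℕ, SimF n k a b ∧ (1 / 2 : ℝ) ^ n + (1 / 2 : ℝ) ^ (n + k) < r := by
  obtain ⟨_, ⟨n, k, hn, rfl⟩, hr⟩ := exists_lt_of_csInf_lt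
    (s := {r : ℝ | ∃ n k : ℕ, SimF n k a b ∧ r = (1/2 : ℝ) ^ n + (1/2 : ℝ) ^ (n + k)})
    ⟨_, 0, 0, ⟨fun _ => trivial, fun _ h => absurd h (Nat.not_lt_zero _)⟩, rfl⟩
    (lt_of_mul_lt_mul_left h (by norm_num))
  exact ⟨n, k, hn, hr⟩

/-- Closed balls for `lm` are given by pointwise conditions depending only on the local heights
of the arguments. -/
theorem lm_le_iff {r : ℝ} (hr : 0 ≤ r) : lm a b ≤ r ↔ ∀ x n,
    r < 1 / 2 * ((1 / 2) ^ n + (1 / 2) ^ (n + ∑ i, localHeight (x i))) →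
      Sim (n + 1) (a x) (b x) := by
  refine ⟨fun h x n hn => ?_, fun h => ?_⟩
  · obtain ⟨n', k', hS, hlt⟩ := exists_simF_of_lm_lt (h.trans_lt hn)
    have hnn : n ≤ n' := by
      by_contra! hlt'
      have h₁ : (1 / 2 : ℝ) ^ n ≤ (1 / 2) ^ (n' + 1) := half_pow_le_iff.2 hlt'
      have h₂ : (1 / 2 : ℝ) ^ (n + ∑ i, localHeight (x i)) ≤ (1 / 2) ^ (n' + 1) :=
        half_pow_le_iff.2 (by omega)
      have h₃ : (0 : ℝ) < (1 / 2) ^ (n' + k') := by positivity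
      rw [pow_succ] at h₁ h₂
      linarith
    rcases hnn.eq_or_lt with rfl | hlt'
    · refine hS.2 x ?_
      have := half_pow_lt_iff.1 (lt_of_add_lt_add_left hlt)
      omega
    · exact (hS.1 x).mono hlt'
  · by_contra! hlt
    have hsim : ∀ n, SimF n 0 a b := fun n => by
      induction n with
      | zero => exact ⟨fun _ => trivial, fun _ h => absurd h (Nat.not_lt_zero _)⟩
      | succ n ih =>
        have hk : ∀ k, SimF n k a b := fun k => by
          induction k with
          | zero => exact ih
          | succ k ihk =>
            refine ⟨ih.1, fun x hx => h x n ((hlt.trans_le (lm_le_of_simF ihk)).trans_le ?_)⟩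
            gcongr _ * (_ + ?_)
            exact half_pow_le_iff.2 (by omega)
        exact ⟨fun x => (hk _).2 x (Nat.lt_succ_self _), fun _ h => absurd h (Nat.not_lt_zero _)⟩
    obtain ⟨n, hn⟩ := exists_pow_lt_of_lt_one (hr.trans_lt hlt) (by norm_num : (1 / 2 : ℝ) < 1)
    have := lm_le_of_simF (hsim n)
    rw [add_zero] at this
    linarith

theorem lm_comm (a b : (Fin m → PP) → PP) : lm a b = lm b a := by
  have : ∀ n k, SimF n k a b ↔ SimF n k b a := fun n k =>
    ⟨fun h => ⟨fun x => (h.1 x).symm, fun x hx => (h.2 x hx).symm⟩,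
      fun h => ⟨fun x => (h.1 x).symm, fun x hx => (h.2 x hx).symm⟩⟩
  simp only [lm, this]

theorem lm_self (a : (Fin m → PP) → PP) : lm a a = 0 :=
  le_antisymm ((lm_le_iff le_rfl).2 fun _ _ _ => Sim.refl _ _) lm_nonneg

theorem eq_of_lm_eq_zero (h : lm a b = 0) : a = b :=
  funext fun x => eq_of_forall_sim fun n => (lm_le_iff le_rfl).1 h.le x n (by positivity)

theorem lm_triangle (a b c : (Fin m → PP) → PP) : lm a c ≤ max (lm a b) (lm b c) := by
  have h0 : 0 ≤ max (lm a b) (lm b c) := lm_nonneg.trans (le_max_left _ _)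
  exact (lm_le_iff h0).2 fun x n hn =>
    ((lm_le_iff h0).1 (le_max_left _ _) x n hn).trans ((lm_le_iff h0).1 (le_max_right _ _) x n hn)

end Distance

/-- A chain of pointwise conditions on a family of maps compatible with all `Sim n` is realised by
another such map. -/
theorem exists_chain_limit {X : Type*} (E : ℕ → X → X → Prop) (c : ℕ → X → PP)
    (hc : ∀ i n x y, E n x y → Sim n (c i x) (c i y)) (Q : ℕ → ℕ → Prop)
    (hQ : ∀ i k n, k ≤ n → Q i n → Q i k)
    (hS : ∀ i j n x, i ≤ j → Q i n → Sim (n + 1) (c i x) (c j x)) :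
    ∃ a : X → PP, (∀ j n x, Q j n → Sim (n + 1) (c j x) (a x)) ∧
      ∀ n x y, E n x y → Sim n (a x) (a y) := by
  have hS' : ∀ i j n x, Q i n → Q j n → Sim (n + 1) (c i x) (c j x) := fun i j n x hi hj =>
    (le_total i j).elim (fun h => hS i j n x h hi) fun h => (hS j i n x h hj).symm
  by_cases hmax : ∃ i, ∀ j n, Q j n → Q i n
  · obtain ⟨i, hi⟩ := hmax
    exact ⟨c i, fun j n x hj => hS' j i n x hj (hi j n hj), hc i⟩
  · push Not at hmax
    have hunb : ∀ n, ∃ i, Q i n := fun n => by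
      induction n with
      | zero =>
        obtain ⟨j, n, hj, -⟩ := hmax 0
        exact ⟨j, hQ j 0 n n.zero_le hj⟩
      | succ n ih =>
        obtain ⟨i, hi⟩ := ih
        obtain ⟨j, k, hj, hik⟩ := hmax i
        exact ⟨j, hQ j _ k (not_le.1 fun h => hik (hQ i k n h hi)) hj⟩
    choose s hs using hunb
    choose a ha using fun x => exists_limit (fun n => c (s n) x) fun n =>
      hS' _ _ n x (hs n) (hQ _ _ _ n.le_succ (hs (n + 1)))
    exact ⟨a, fun j n x hj => (hS' j (s n) n x hj (hs n)).trans (ha x n), fun n x y hxy =>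
      ((ha x n).of_succ.symm.trans (hc (s n) n x y hxy)).trans (ha y n).of_succ⟩

theorem isUltrametric_lm (m : ℕ) : IsUltrametric (fun a b : Fm m => lm a.1 b.1) :=
  ⟨fun _ _ => lm_nonneg,
    fun _ b => ⟨fun h => Subtype.ext (eq_of_lm_eq_zero h), fun h => h ▸ lm_self b.1⟩,
    fun _ _ => lm_comm _ _, fun _ _ _ => lm_triangle _ _ _⟩

theorem sphericallyComplete_lm (m : ℕ) :
    SphericallyComplete (fun a b : Fm m => lm a.1 b.1) := by
  intro c r hr hsub
  have hanti : Antitone fun n => cBall (fun a b : Fm m => lm a.1 b.1) (c n) (r n) :=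
    antitone_nat_of_succ_le hsub
  have hdist : ∀ i j, i ≤ j → lm (c i).1 (c j).1 ≤ r i := fun i j hij =>
    hanti hij ((lm_self (c j).1).trans_le (hr j))
  choose A hA hE using fun h : ℕ => exists_chain_limit
    (X := {x : Fin m → PP // ∑ i, localHeight (x i) = h})
    (fun n x y => ∀ i, Sim n (x.1 i) (y.1 i)) (fun j x => (c j).1 x.1)
    (fun j n x y => nonExpansiveM_iff.1 (c j).2 n x.1 y.1)
    (fun j n => r j < 1 / 2 * ((1 / 2) ^ n + (1 / 2) ^ (n + h)))
    (fun j k n hkn hj => hj.trans_le (by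
      gcongr _ * (?_ + ?_) <;> exact half_pow_le_iff.2 (by omega)))
    (fun i j n x hij hi => (lm_le_iff (hr i)).1 (hdist i j hij) x.1 n (by rwa [x.2]))
  refine ⟨⟨fun x => A _ ⟨x, rfl⟩, nonExpansiveM_iff.2 fun n x y hxy => ?_⟩, fun j =>
    (lm_le_iff (hr j)).2 fun x n hn => hA _ j n ⟨x, rfl⟩ hn⟩
  cases n with
  | zero => trivial
  | succ n =>
    have hxy' : ∑ i, localHeight (y i) = ∑ i, localHeight (x i) :=
      Finset.sum_congr rfl fun i _ => (localHeight_eq_of_sim (hxy i)).symm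
    have hy : ∀ h (e : ∑ i, localHeight (y i) = h), A _ ⟨y, rfl⟩ = A h ⟨y, e⟩ := by
      rintro _ rfl
      rfl
    rw [hy _ hxy']
    exact hE _ (n + 1) ⟨x, rfl⟩ ⟨y, hxy'⟩ hxy

theorem stmt10 (m : ℕ) :
    IsUltrametric (fun a b : Fm m => lm a.1 b.1) ∧
    SphericallyComplete (fun a b : Fm m => lm a.1 b.1) :=
  ⟨isUltrametric_lm m, sphericallyComplete_lm m⟩
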